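/- Let T be a Y(2|1) T-family in A, let a ≥ 1, b ≥ 0, and let ū = (u₁,…,u_a), v̄ = (v₁,…,v_b) be lists whose concatenation is admissible. Then X_{a,b}(ū,v̄) = T₁₂(u_a)·X_{a−1,b}(ū_a, v̄) + Σ_{j=1}^{b} g(vⱼ,u_a)·f(vⱼ,ū_a)·g(v̄ⱼ,vⱼ)·T₁₃(u_a)·X_{a−1,b−1}(ū_a, v̄ⱼ)·T₂₂(vⱼ), where ū_a = ū with u_a removed, v̄ⱼ = v̄ with vⱼ removed, f(vⱼ,ū_a) = ∏_{k<a} f(vⱼ,uₖ) and g(v̄ⱼ,vⱼ) = ∏_{k≠j} g(vₖ,vⱼ). -/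

import Mathlib

open scoped BigOperators
open MulOpposite

noncomputable section

namespace Bethe

variable {A : Type*} [Ring A] [Algebra ℂ A]

/-- `g(u,v) = c/(u-v)` -/
def gg (c u v : ℂ) : ℂ := c / (u - v)

/-- `f(u,v) = (u-v+c)/(u-v)` -/
def ff (c u v : ℂ) : ℂ := (u - v + c) / (u - v)

/-- `h(u,v) = (u-v+c)/c` -/
def hh (c u v : ℂ) : ℂ := (u - v + c) / c

/-- A list of parameters is admissible if its entries are pairwise distinct and
`x - y + c ≠ 0` for any two distinct entries `x`, `y`. -/
def Admissible (c : ℂ) (l : List ℂ) : Prop :=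
  l.Pairwise fun x y => x ≠ y ∧ x - y + c ≠ 0 ∧ y - x + c ≠ 0

/-- `∏_{x ∈ xs} ∏_{y ∈ ys} f(x,y)` -/
def prodFF (c : ℂ) (xs ys : List ℂ) : ℂ :=
  (xs.map fun x => (ys.map fun y => ff c x y).prod).prod

/-- `∏_{x ∈ xs} ∏_{y ∈ ys} g(x,y)` -/
def prodGG (c : ℂ) (xs ys : List ℂ) : ℂ :=
  (xs.map fun x => (ys.map fun y => gg c x y).prod).prod

/-- `∏_{x ∈ xs} ∏_{y ∈ ys} h(x,y)` -/
def prodHH (c : ℂ) (xs ys : List ℂ) : ℂ :=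
  (xs.map fun x => (ys.map fun y => hh c x y).prod).prod

/-- `H(w̄) = ∏_{j>k} h(wⱼ,wₖ)` -/
def Hnorm (c : ℂ) : List ℂ → ℂ
  | [] => 1
  | x :: xs => ((xs.map fun y => hh c y x).prod) * Hnorm c xs

/-- `H(w̄*) = ∏_{j<k} h(wⱼ,wₖ)` -/
def HnormRev (c : ℂ) : List ℂ → ℂ
  | [] => 1
  | x :: xs => ((xs.map fun y => hh c x y).prod) * HnormRev c xs

/-- product of `h` over ordered pairs of distinct positions of a list -/
def prodHHne (c : ℂ) (xs : List ℂ) : ℂ :=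
  ∏ j : Fin xs.length, ∏ k : Fin xs.length,
    if j ≠ k then hh c (xs.get j) (xs.get k) else 1

/-- ordered product `T(w₁)⋯T(wₙ)` -/
def Tprod (Tij : ℂ → A) (l : List ℂ) : A := (l.map Tij).prod

/-- normalized ordered product `H(w̄)⁻¹ T(w₁)⋯T(wₙ)` -/
def TT (c : ℂ) (Tij : ℂ → A) (l : List ℂ) : A := (Hnorm c l)⁻¹ • Tprod Tij l

/-- normalized ordered product `H(w̄*)⁻¹ T(w₁)⋯T(wₙ)` -/
def TTrev (c : ℂ) (Tij : ℂ → A) (l : List ℂ) : A := (HnormRev c l)⁻¹ • Tprod Tij l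

/-- The defining (RTT) commutation relations of a super-Yangian `T`-family with
`ℤ₂`-grading `p`. -/
def IsTFam (c : ℂ) {N : ℕ} (p : Fin N → ℕ) (T : Fin N → Fin N → ℂ → A) : Prop :=
  ∀ i j k l : Fin N, ∀ z w : ℂ, z ≠ w →
    T i j z * T k l w - ((-1 : ℂ) ^ ((p i + p j) * (p k + p l))) • (T k l w * T i j z)
      = ((-1 : ℂ) ^ (p l * (p i + p j) + p i * p j) * gg c z w) •
          (T i l z * T k j w - T i l w * T k j z)

/-- the distinguished grading of `gl(2|1)`: `[1]=[2]=0`, `[3]=1` -/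
def p21 : Fin 3 → ℕ := ![0, 0, 1]

/-- the distinguished grading of `gl(1|2)`: `[1]=0`, `[2]=[3]=1` -/
def p12 : Fin 3 → ℕ := ![0, 1, 1]

/-- the sublist of `l` given by the positions in `S`, in the inherited order -/
def sel (l : List ℂ) (S : Finset (Fin l.length)) : List ℂ :=
  (S.sort (· ≤ ·)).map l.get

/-- `λ(w̄) = ∏ⱼ λ(wⱼ)` -/
def lamP (lam2 : ℂ → ℂ) (l : List ℂ) : ℂ := (l.map lam2).prod

/-- The Izergin kernel `K_ℓ(v̄|ū)`. -/
def Kiz (c : ℂ) {ℓ : ℕ} (vs us : Fin ℓ → ℂ) : ℂ :=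
  (∏ j : Fin ℓ, ∏ k : Fin ℓ, if (k : ℕ) < (j : ℕ) then gg c (vs j) (vs k) else 1) *
    (∏ j : Fin ℓ, ∏ k : Fin ℓ, if (k : ℕ) < (j : ℕ) then gg c (us k) (us j) else 1) *
    (∏ j : Fin ℓ, ∏ k : Fin ℓ, hh c (vs j) (us k)) *
    Matrix.det (Matrix.of fun j k => gg c (vs j) (us k) / hh c (vs j) (us k))

/-- The Izergin kernel for lists of equal length (and junk value `0` otherwise). -/
def KizL (c : ℂ) (vs us : List ℂ) : ℂ :=
  if h : vs.length = us.length then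
    Kiz c vs.get fun j => us.get (Fin.cast h j)
  else 0

/-- The operator `X_{a,b}(ū,v̄)` of the paper (`Y(2|1)` case). -/
def X (c : ℂ) (T : Fin 3 → Fin 3 → ℂ → A) (u v : List ℂ) : A :=
  ∑ S : Finset (Fin u.length), ∑ Q : Finset (Fin v.length),
    if S.card = Q.card then
      (prodGG c (sel v Q) (sel u S) * prodFF c (sel u S) (sel u Sᶜ) *
          prodGG c (sel v Qᶜ) (sel v Q) * prodHHne c (sel u S)) •
        (TT c (T 0 2) (sel u S) * Tprod (T 0 1) (sel u Sᶜ) *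
          TT c (T 1 2) (sel v Qᶜ) * Tprod (T 1 1) (sel v Q))
    else 0

/-- The operator `Y_{a,b}(ū,v̄)` of the paper (`Y(2|1)` case). -/
def Y (c : ℂ) (T : Fin 3 → Fin 3 → ℂ → A) (u v : List ℂ) : A :=
  ∑ S : Finset (Fin u.length), ∑ Q : Finset (Fin v.length),
    if S.card = Q.card then
      (KizL c (sel v Q) (sel u S) * prodFF c (sel u S) (sel u Sᶜ) *
          prodGG c (sel v Qᶜ) (sel v Q)) •
        (TT c (T 0 2) (sel v Q) * TT c (T 1 2) (sel v Qᶜ) *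
          Tprod (T 0 1) (sel u Sᶜ) * Tprod (T 1 1) (sel u S))
    else 0

/-- First explicit expression for the `Y(2|1)` Bethe vector (operator part,
the weights `λ₂` included as scalars). -/
def PhiA (c : ℂ) (T : Fin 3 → Fin 3 → ℂ → A) (lam2 : ℂ → ℂ) (u v : List ℂ) : A :=
  ∑ S : Finset (Fin u.length), ∑ Q : Finset (Fin v.length),
    if S.card = Q.card then
      (prodGG c (sel v Q) (sel u S) * prodFF c (sel u S) (sel u Sᶜ) *
          prodGG c (sel v Qᶜ) (sel v Q) * prodHHne c (sel u S) * lamP lam2 (sel v Q)) •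
        (TT c (T 0 2) (sel u S) * Tprod (T 0 1) (sel u Sᶜ) * TT c (T 1 2) (sel v Qᶜ))
    else 0

/-- Second explicit expression for the `Y(2|1)` Bethe vector (operator part). -/
def PhiB (c : ℂ) (T : Fin 3 → Fin 3 → ℂ → A) (lam2 : ℂ → ℂ) (u v : List ℂ) : A :=
  ∑ S : Finset (Fin u.length), ∑ Q : Finset (Fin v.length),
    if S.card = Q.card then
      (KizL c (sel v Q) (sel u S) * prodFF c (sel u S) (sel u Sᶜ) *
          prodGG c (sel v Qᶜ) (sel v Q) * lamP lam2 (sel u S)) •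
        (TT c (T 0 2) (sel v Q) * TT c (T 1 2) (sel v Qᶜ) * Tprod (T 0 1) (sel u Sᶜ))
    else 0

/-- First explicit expression for the `Y(1|2)` Bethe vector, without the overall
sign `(-1)^b` (operator part). -/
def PhiTA (c : ℂ) (T : Fin 3 → Fin 3 → ℂ → A) (lam2 : ℂ → ℂ) (u v : List ℂ) : A :=
  ∑ S : Finset (Fin u.length), ∑ Q : Finset (Fin v.length),
    if S.card = Q.card then
      (prodGG c (sel u S) (sel v Q) * prodFF c (sel v Q) (sel v Qᶜ) *
          prodGG c (sel u Sᶜ) (sel u S) * prodHHne c (sel v Q) * lamP lam2 (sel u S)) •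
        (TT c (T 0 2) (sel v Q) * Tprod (T 1 2) (sel v Qᶜ) * TT c (T 0 1) (sel u Sᶜ))
    else 0

/-- Second explicit expression for the `Y(1|2)` Bethe vector, without the overall
sign `(-1)^b` (operator part). -/
def PhiTB (c : ℂ) (T : Fin 3 → Fin 3 → ℂ → A) (lam2 : ℂ → ℂ) (u v : List ℂ) : A :=
  ∑ S : Finset (Fin u.length), ∑ Q : Finset (Fin v.length),
    if S.card = Q.card then
      (KizL c (sel u S) (sel v Q) * prodFF c (sel v Q) (sel v Qᶜ) *
          prodGG c (sel u Sᶜ) (sel u S) * lamP lam2 (sel v Q)) •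
        (TT c (T 0 2) (sel u S) * TT c (T 0 1) (sel u Sᶜ) * Tprod (T 1 2) (sel v Qᶜ))
    else 0

/-- First explicit expression for the dual `Y(2|1)` Bethe vector, without the
overall sign `(-1)^{b(b-1)/2}`.  `E` is a right `A`-module, i.e. a left
`Aᵐᵒᵖ`-module; `op X • Ωd` is `Ωd · X`. -/
def PsiA {E : Type*} [AddCommGroup E] [Module ℂ E] [Module Aᵐᵒᵖ E]
    (c : ℂ) (T : Fin 3 → Fin 3 → ℂ → A) (lam2 : ℂ → ℂ) (u v : List ℂ) (Ωd : E) : E :=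
  ∑ S : Finset (Fin u.length), ∑ Q : Finset (Fin v.length),
    if S.card = Q.card then
      (prodGG c (sel v Q) (sel u S) * prodFF c (sel u S) (sel u Sᶜ) *
          prodGG c (sel v Qᶜ) (sel v Q) * prodHHne c (sel u S) * lamP lam2 (sel v Q)) •
        (op (TTrev c (T 2 1) (sel v Qᶜ) * Tprod (T 1 0) (sel u Sᶜ) *
              TTrev c (T 2 0) (sel u S)) • Ωd)
    else 0

/-- The dual `Y(2|1)` Bethe vector `Ψ_{a,b}(ū,v̄)`. -/
def Psi {E : Type*} [AddCommGroup E] [Module ℂ E] [Module Aᵐᵒᵖ E]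
    (c : ℂ) (T : Fin 3 → Fin 3 → ℂ → A) (lam2 : ℂ → ℂ) (u v : List ℂ) (Ωd : E) : E :=
  ((-1 : ℂ) ^ (v.length * (v.length - 1) / 2)) • PsiA c T lam2 u v Ωd

/-- Second explicit expression for the dual `Y(2|1)` Bethe vector, without the
overall sign `(-1)^{b(b-1)/2}`. -/
def PsiB {E : Type*} [AddCommGroup E] [Module ℂ E] [Module Aᵐᵒᵖ E]
    (c : ℂ) (T : Fin 3 → Fin 3 → ℂ → A) (lam2 : ℂ → ℂ) (u v : List ℂ) (Ωd : E) : E :=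
  ∑ S : Finset (Fin u.length), ∑ Q : Finset (Fin v.length),
    if S.card = Q.card then
      (KizL c (sel v Q) (sel u S) * prodFF c (sel u S) (sel u Sᶜ) *
          prodGG c (sel v Qᶜ) (sel v Q) * lamP lam2 (sel u S)) •
        (op (Tprod (T 1 0) (sel u Sᶜ) * TTrev c (T 2 1) (sel v Qᶜ) *
              TTrev c (T 2 0) (sel v Q)) • Ωd)
    else 0

set_option linter.unusedSectionVars false

/-! ### Relations -/

/-- good pair -/
def GP (c : ℂ) (x y : ℂ) : Prop := x ≠ y ∧ x - y + c ≠ 0 ∧ y - x + c ≠ 0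

lemma GP.symm {c x y : ℂ} (h : GP c x y) : GP c y x := ⟨h.1.symm, h.2.2, h.2.1⟩

lemma commute_of_rel {c : ℂ} {B : ℂ → A}
    (h : ∀ z w, z ≠ w → B z * B w - B w * B z = gg c z w • (B z * B w - B w * B z)) (z w : ℂ) :
    Commute (B z) (B w) := by
  by_cases hzw : z = w
  · subst hzw; exact Commute.refl _
  have h1 := h z w hzw
  have h2 := h w z (Ne.symm hzw)
  have hg : gg c w z = - gg c z w := by
    unfold gg; rw [← neg_sub z w, div_neg]
  rw [hg] at h2
  set D := B z * B w - B w * B z with hD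
  have hD' : B w * B z - B z * B w = - D := by rw [hD]; abel
  rw [hD', smul_neg, neg_smul, neg_neg] at h2
  have h3 : D = - D := by rw [h2]; exact h1.trans (by rfl)
  have h4 : (2 : ℂ) • D = 0 := by
    rw [two_smul]; nth_rewrite 2 [h3]; abel
  have h5 : D = 0 := by
    have := congrArg (fun t => (2 : ℂ)⁻¹ • t) h4
    simpa [smul_smul] using this
  exact sub_eq_zero.mp h5

lemma comm01 {c : ℂ} {T : Fin 3 → Fin 3 → ℂ → A} (hT : IsTFam c p21 T) (z w : ℂ) :
    Commute (T 0 1 z) (T 0 1 w) := by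
  refine commute_of_rel (c := c) (fun z w hzw => ?_) z w
  have := hT 0 1 0 1 z w hzw
  simpa [p21] using this

lemma comm11 {c : ℂ} {T : Fin 3 → Fin 3 → ℂ → A} (hT : IsTFam c p21 T) (z w : ℂ) :
    Commute (T 1 1 z) (T 1 1 w) := by
  refine commute_of_rel (c := c) (fun z w hzw => ?_) z w
  have := hT 1 1 1 1 z w hzw
  simpa [p21] using this

/-- fermionic exchange -/
def Ferm (c : ℂ) (B : ℂ → A) : Prop :=
  ∀ z w, z ≠ w → hh c z w • (B z * B w) = hh c w z • (B w * B z)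

lemma ferm_of_rel {c : ℂ} (hc : c ≠ 0) {B : ℂ → A}
    (h : ∀ z w, z ≠ w → B z * B w + B w * B z = -(gg c z w • (B z * B w - B w * B z))) :
    Ferm c B := by
  intro z w hzw
  have h1 := h z w hzw
  have hzw' := sub_ne_zero.mpr hzw
  have e1 : hh c z w = ((z - w) / c) * (1 + gg c z w) := by
    unfold hh gg; field_simp
  have e2 : hh c w z = ((z - w) / c) * (-1 + gg c z w) := by
    unfold hh gg; field_simp; ring
  rw [e1, e2, mul_smul, mul_smul]
  congr 1
  have h2 : B z * B w + B w * B z + gg c z w • (B z * B w - B w * B z) = 0 := by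
    rw [h1]; abel
  rw [← sub_eq_zero, ← h2]
  module

lemma ferm02 {c : ℂ} (hc : c ≠ 0) {T : Fin 3 → Fin 3 → ℂ → A} (hT : IsTFam c p21 T) :
    Ferm c (T 0 2) := by
  refine ferm_of_rel hc (fun z w hzw => ?_)
  have := hT 0 2 0 2 z w hzw
  simpa [p21] using this

lemma ferm12 {c : ℂ} (hc : c ≠ 0) {T : Fin 3 → Fin 3 → ℂ → A} (hT : IsTFam c p21 T) :
    Ferm c (T 1 2) := by
  refine ferm_of_rel hc (fun z w hzw => ?_)
  have := hT 1 2 1 2 z w hzw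
  simpa [p21] using this

lemma ex0102 {c : ℂ} {T : Fin 3 → Fin 3 → ℂ → A} (hT : IsTFam c p21 T) (z w : ℂ)
    (hzw : z ≠ w) :
    T 0 1 z * T 0 2 w = ff c w z • (T 0 2 w * T 0 1 z) + gg c z w • (T 0 2 z * T 0 1 w) := by
  have h := hT 0 1 0 2 z w hzw
  have hzw' := sub_ne_zero.mpr hzw
  have hzw'' := sub_ne_zero.mpr hzw.symm
  have e : ff c w z = 1 - gg c z w := by
    unfold ff gg; rw [← neg_sub w z]; field_simp; ring
  simp [p21] at h
  rw [e, sub_eq_iff_eq_add.mp h]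
  module

/-! ### Symmetry of ordered products -/

lemma Tprod_perm {B : ℂ → A} (hB : ∀ z w, Commute (B z) (B w)) {l l' : List ℂ}
    (h : l.Perm l') : Tprod B l = Tprod B l' := by
  unfold Tprod
  refine (h.map B).prod_eq' ?_
  rw [List.pairwise_map]
  exact List.pairwise_of_forall (fun x y => hB x y)

lemma hh_ne {c x y : ℂ} (hc : c ≠ 0) (h : GP c x y) : hh c x y ≠ 0 :=
  div_ne_zero h.2.1 hc

lemma TT_cons (c : ℂ) (B : ℂ → A) (x : ℂ) (l : List ℂ) :
    TT c B (x :: l) = ((l.map fun y => hh c y x).prod)⁻¹ • (B x * TT c B l) := by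
  unfold TT Tprod
  rw [Hnorm, mul_inv, mul_smul, List.map_cons, List.prod_cons, mul_smul_comm]

lemma TT_perm {c : ℂ} (hc : c ≠ 0) {B : ℂ → A} (hB : Ferm c B) {l l' : List ℂ}
    (h : l.Perm l') (hp : l.Pairwise (GP c)) : TT c B l = TT c B l' := by
  induction h with
  | nil => rfl
  | cons x h ih =>
    rw [TT_cons, TT_cons, ih (List.pairwise_cons.mp hp).2, (h.map _).prod_eq]
  | swap x y l =>
    rw [TT_cons, TT_cons, TT_cons, TT_cons]
    have hxy : GP c y x := (List.pairwise_cons.mp hp).1 x (by simp)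
    have h1 := hB y x hxy.1
    have n1 := hh_ne hc hxy
    have n2 := hh_ne hc hxy.symm
    simp only [List.map_cons, List.prod_cons, mul_inv, mul_smul_comm, ← mul_assoc, smul_smul]
    have h2 : B y * B x = ((hh c y x)⁻¹ * hh c x y) • (B x * B y) := by
      rw [mul_smul, ← h1, smul_smul, inv_mul_cancel₀ n1, one_smul]
    rw [h2, smul_mul_assoc, smul_smul]
    congr 1
    field_simp
  | trans h1 h2 ih1 ih2 =>
    rw [ih1 hp, ih2 ((h1.pairwise_iff (fun h => GP.symm h)).mp hp)]

/-! ### Finset versions -/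

/-- admissible finset -/
def FA (c : ℂ) (s : Finset ℂ) : Prop := ∀ x ∈ s, ∀ y ∈ s, x ≠ y → GP c x y

lemma FA.mono {c : ℂ} {s t : Finset ℂ} (h : FA c t) (hst : s ⊆ t) : FA c s :=
  fun x hx y hy => h x (hst hx) y (hst hy)

lemma FA.pairwise {c : ℂ} {s : Finset ℂ} (h : FA c s) {l : List ℂ} (hn : l.Nodup)
    (hl : ∀ x ∈ l, x ∈ s) : l.Pairwise (GP c) :=
  hn.imp_of_mem (fun {x y} hx hy hne => h x (hl x hx) y (hl y hy) hne)

def TTf (c : ℂ) (B : ℂ → A) (s : Finset ℂ) : A := TT c B s.toList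
def TPf (B : ℂ → A) (s : Finset ℂ) : A := Tprod B s.toList

lemma TPf_insert {B : ℂ → A} (hB : ∀ z w, Commute (B z) (B w)) {x : ℂ} {s : Finset ℂ}
    (hx : x ∉ s) : TPf B (insert x s) = B x * TPf B s := by
  unfold TPf
  rw [Tprod_perm hB (Finset.toList_insert hx)]
  simp [Tprod]

lemma TPf_insert' {B : ℂ → A} (hB : ∀ z w, Commute (B z) (B w)) {x : ℂ} {s : Finset ℂ}
    (hx : x ∉ s) : TPf B (insert x s) = TPf B s * B x := by
  rw [TPf_insert hB hx]
  refine Commute.list_prod_right _ _ ?_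
  intro y hy
  obtain ⟨w, -, rfl⟩ := List.mem_map.mp hy
  exact hB x w

lemma TTf_insert {c : ℂ} (hc : c ≠ 0) {B : ℂ → A} (hB : Ferm c B) {x : ℂ} {s : Finset ℂ}
    (hx : x ∉ s) (hs : FA c (insert x s)) :
    TTf c B (insert x s) = (∏ y ∈ s, hh c y x)⁻¹ • (B x * TTf c B s) := by
  unfold TTf
  rw [TT_perm hc hB (Finset.toList_insert hx)
    (hs.pairwise (Finset.nodup_toList _) (by simp)), TT_cons, Finset.prod_map_toList]

lemma mul_TTf {c : ℂ} (hc : c ≠ 0) {B : ℂ → A} (hB : Ferm c B) {x : ℂ} {s : Finset ℂ}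
    (hx : x ∉ s) (hs : FA c (insert x s)) :
    B x * TTf c B s = (∏ y ∈ s, hh c y x) • TTf c B (insert x s) := by
  rw [TTf_insert hc hB hx hs, smul_smul, mul_inv_cancel₀, one_smul]
  refine Finset.prod_ne_zero_iff.mpr (fun y hy => hh_ne hc ?_)
  exact hs _ (by simp [hy]) _ (by simp) (fun h => hx (h ▸ hy))

/-! ### Exchange lemma -/

lemma exch_scalar {c s z k : ℂ} (hc : c ≠ 0) (hsz : s ≠ z) (hsk : s ≠ k) (hzk : z ≠ k) :
    ff c s z * gg c z k * hh c z s + gg c z s * gg c s k * hh c s z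
      = hh c k s * (gg c z k * gg c s k * hh c s z) := by
  have h1 := sub_ne_zero.mpr hsz
  have h1' := sub_ne_zero.mpr hsz.symm
  have h2 := sub_ne_zero.mpr hsk
  have h3 := sub_ne_zero.mpr hzk
  have e : gg c z s = - gg c s z := by unfold gg; rw [← neg_sub s z, div_neg]
  rw [e]
  unfold ff gg hh
  field_simp
  ring

lemma ff_eq {c x y : ℂ} (hc : c ≠ 0) : ff c x y = gg c x y * hh c x y := by
  unfold ff gg hh; field_simp

lemma exch {c : ℂ} (hc : c ≠ 0) {T : Fin 3 → Fin 3 → ℂ → A} (hT : IsTFam c p21 T)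
    (S : Finset ℂ) : ∀ z, z ∉ S → FA c (insert z S) →
    T 0 1 z * TTf c (T 0 2) S = (∏ x ∈ S, ff c x z) • (TTf c (T 0 2) S * T 0 1 z)
      + ∑ k ∈ S, (gg c z k * ∏ x ∈ S.erase k, (gg c x k * hh c x z)) •
          (TTf c (T 0 2) (insert z (S.erase k)) * T 0 1 k) := by
  have hB := ferm02 hc hT
  induction S using Finset.induction_on with
  | empty => intro z _ _; simp [TTf, TT, Tprod, Hnorm]
  | insert s S hs ih =>
    intro z hz hF
    have hzs : z ≠ s := fun h => hz (by simp [h])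
    have hzS : z ∉ S := fun h => hz (by simp [h])
    have hFs : FA c (insert s S) := hF.mono (Finset.subset_insert _ _)
    have hFz : FA c (insert z S) := hF.mono (by
      intro x hx; simp only [Finset.mem_insert] at hx ⊢; tauto)
    have key : (∏ y ∈ S, hh c y s) ≠ 0 :=
      Finset.prod_ne_zero_iff.mpr (fun y hy => hh_ne hc
        (hFs _ (by simp [hy]) _ (by simp) (fun h => hs (h ▸ hy))))
    have step : (∏ y ∈ S, hh c y s) • (T 0 1 z * TTf c (T 0 2) (insert s S))
        = ff c s z • (T 0 2 s * (T 0 1 z * TTf c (T 0 2) S))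
          + gg c z s • (T 0 2 z * (T 0 1 s * TTf c (T 0 2) S)) := by
      rw [← mul_smul_comm, ← mul_TTf hc hB hs hFs, ← mul_assoc, ex0102 hT z s hzs]
      simp only [add_mul, smul_mul_assoc, mul_assoc]
    refine (smul_right_injective A key) ?_
    show (∏ y ∈ S, hh c y s) • _ = (∏ y ∈ S, hh c y s) • _
    rw [step, ih z hzS hFz, ih s hs hFs, Finset.sum_insert hs, Finset.erase_insert hs,
      Finset.prod_insert hs]
    simp only [mul_add, smul_add, mul_smul_comm, Finset.mul_sum, Finset.smul_sum, smul_smul,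
      ← mul_assoc]
    rw [mul_TTf hc hB hs hFs, mul_TTf hc hB hzS hFz]
    have e1 : (∏ x ∈ S, ff c x s) = (∏ x ∈ S, gg c x s) * ∏ x ∈ S, hh c x s := by
      rw [← Finset.prod_mul_distrib]; exact Finset.prod_congr rfl (fun x _ => ff_eq hc)
    have e2 : ∀ k ∈ S,
        (ff c s z * (gg c z k * ∏ x ∈ S.erase k, (gg c x k * hh c x z))) •
            (T 0 2 s * TTf c (T 0 2) (insert z (S.erase k)) * T 0 1 k)
        + (gg c z s * (gg c s k * ∏ x ∈ S.erase k, (gg c x k * hh c x s))) •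
            (T 0 2 z * TTf c (T 0 2) (insert s (S.erase k)) * T 0 1 k)
        = ((∏ y ∈ S, hh c y s) * (gg c z k * ∏ x ∈ (insert s S).erase k,
              (gg c x k * hh c x z))) •
            (TTf c (T 0 2) (insert z ((insert s S).erase k)) * T 0 1 k) := by
      intro k hk
      have hsk : s ≠ k := fun h => hs (h ▸ hk)
      have hzk : z ≠ k := fun h => hzS (h ▸ hk)
      have hse : s ∉ S.erase k := fun h => hs (Finset.mem_of_mem_erase h)
      have hze : z ∉ S.erase k := fun h => hzS (Finset.mem_of_mem_erase h)
      have hsub : insert s (insert z (S.erase k)) ⊆ insert z (insert s S) := by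
        intro x hx
        simp only [Finset.mem_insert, Finset.mem_erase] at hx ⊢; tauto
      have hs1 : s ∉ insert z (S.erase k) := by
        simp only [Finset.mem_insert, not_or]; exact ⟨hzs.symm, hse⟩
      have hz1 : z ∉ insert s (S.erase k) := by
        simp only [Finset.mem_insert, not_or]; exact ⟨hzs, hze⟩
      rw [mul_TTf hc hB hs1 (hF.mono hsub),
        mul_TTf hc hB hz1 (by rw [Finset.insert_comm]; exact hF.mono hsub),
        Finset.erase_insert_of_ne hsk, Finset.prod_insert hse, Finset.prod_insert hze,
        Finset.prod_insert hse, ← Finset.mul_prod_erase S _ hk, Finset.insert_comm s z]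
      simp only [smul_mul_assoc, smul_smul, ← add_smul, Finset.prod_mul_distrib]
      congr 1
      have := exch_scalar hc hzs.symm hsk hzk
      linear_combination ((∏ x ∈ S.erase k, gg c x k) * (∏ x ∈ S.erase k, hh c x z) *
        ∏ x ∈ S.erase k, hh c x s) * this
    simp only [← mul_assoc] at e2
    rw [← Finset.sum_congr rfl e2, Finset.sum_add_distrib, e1]
    simp only [smul_mul_assoc, smul_smul, Finset.prod_mul_distrib]
    module

/-! ### Partial fractions -/

lemma partial_fractions {c : ℂ} (hc : c ≠ 0) {I J Q : Finset ℂ} {a : ℂ}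
    (hcard : I.card + 1 = Q.card) (hJQ : Disjoint J Q) (haJ : a ∉ J) (haQ : a ∉ Q) :
    (∏ v ∈ Q, gg c v a) * (∏ u ∈ J, ff c a u) * (∏ u ∈ I, hh c a u)
      = ∑ k ∈ J, (∏ v ∈ Q, gg c v k) * (∏ u ∈ J.erase k, ff c k u) * (∏ u ∈ I, hh c k u) * gg c a k
      + ∑ j ∈ Q, gg c j a * (∏ u ∈ J, ff c j u) * (∏ u ∈ I, hh c j u) * ∏ v ∈ Q.erase j, gg c v j := by
  classical
  set N : Polynomial ℂ := (∏ u ∈ J, (Polynomial.X - Polynomial.C (u - c))) *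
    ∏ u ∈ I, (Polynomial.X - Polynomial.C (u - c)) with hN
  have hNe : ∀ z, N.eval z = (∏ u ∈ J, (z - u + c)) * ∏ u ∈ I, (z - u + c) := by
    intro z
    rw [hN, Polynomial.eval_mul, Polynomial.eval_prod, Polynomial.eval_prod]
    congr 1 <;> refine Finset.prod_congr rfl (fun u _ => ?_) <;> simp <;> ring
  have hdeg : N.degree < (J ∪ Q).card := by
    rw [hN, Polynomial.degree_mul, Polynomial.degree_prod, Polynomial.degree_prod,
      Finset.card_union_of_disjoint hJQ]
    simp only [Polynomial.degree_X_sub_C, Finset.sum_const, nsmul_eq_mul, mul_one]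
    rw [← hcard]
    norm_cast
    omega
  have hinj : Set.InjOn (id : ℂ → ℂ) (J ∪ Q : Finset ℂ) := Function.injective_id.injOn
  have L := Lagrange.eq_interpolate hinj hdeg
  have L2 := congrArg (Polynomial.eval a) L
  have haW : ∀ i ∈ J ∪ Q, a ≠ id i := by
    intro i hi h
    simp only [id] at h
    subst h
    rcases Finset.mem_union.mp hi with h | h
    · exact haJ h
    · exact haQ h
  rw [Lagrange.eval_interpolate_not_at_node _ haW, Lagrange.eval_nodal,
    Finset.sum_union hJQ, Finset.prod_union hJQ, hNe] at L2
  simp only [id, Lagrange.nodalWeight, hNe] at L2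
  have hcI : c ^ I.card ≠ 0 := pow_ne_zero _ hc
  have gprod : ∀ (s : Finset ℂ) (z : ℂ), ∏ v ∈ s, gg c v z
      = (-c) ^ s.card * ∏ v ∈ s, (z - v)⁻¹ := by
    intro s z
    rw [← Finset.prod_const, ← Finset.prod_mul_distrib]
    refine Finset.prod_congr rfl (fun v _ => ?_)
    unfold gg; rw [← neg_sub z v, div_neg, neg_mul, div_eq_mul_inv]
  have fprod : ∀ (s : Finset ℂ) (z : ℂ), ∏ u ∈ s, ff c z u
      = (∏ u ∈ s, (z - u + c)) * ∏ v ∈ s, (z - v)⁻¹ := by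
    intro s z
    rw [← Finset.prod_mul_distrib]
    exact Finset.prod_congr rfl (fun v _ => by unfold ff; rw [div_eq_mul_inv])
  have hprod : ∀ (s : Finset ℂ) (z : ℂ), ∏ u ∈ s, hh c z u
      = (∏ u ∈ s, (z - u + c)) * (c⁻¹) ^ s.card := by
    intro s z
    rw [← Finset.prod_const, ← Finset.prod_mul_distrib]
    exact Finset.prod_congr rfl (fun v _ => by unfold hh; rw [div_eq_mul_inv])
  have nJ : ∏ u ∈ J, (a - u) ≠ 0 :=
    Finset.prod_ne_zero_iff.mpr (fun u hu => sub_ne_zero.mpr (fun h => haJ (h ▸ hu)))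
  have nQ : ∏ u ∈ Q, (a - u) ≠ 0 :=
    Finset.prod_ne_zero_iff.mpr (fun u hu => sub_ne_zero.mpr (fun h => haQ (h ▸ hu)))
  have lhs : (∏ v ∈ Q, gg c v a) * (∏ u ∈ J, ff c a u) * (∏ u ∈ I, hh c a u)
      = ((-c) ^ Q.card * (c⁻¹) ^ I.card) * (((∏ u ∈ J, (a - u)) * ∏ u ∈ Q, (a - u))⁻¹ *
        ((∏ u ∈ J, (a - u + c)) * ∏ u ∈ I, (a - u + c))) := by
    rw [gprod, fprod, hprod, mul_inv, ← Finset.prod_inv_distrib, ← Finset.prod_inv_distrib]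
    ring
  rw [lhs, L2, inv_mul_cancel_left₀ (mul_ne_zero nJ nQ), mul_add, Finset.mul_sum, Finset.mul_sum]
  congr 1
  · refine Finset.sum_congr rfl (fun k hk => ?_)
    have hkQ : k ∉ Q := Finset.disjoint_left.mp hJQ hk
    have e1 : (J ∪ Q).erase k = J.erase k ∪ Q := by
      rw [Finset.erase_union_distrib, Finset.erase_eq_of_notMem hkQ]
    have d1 : Disjoint (J.erase k) Q := hJQ.mono_left (Finset.erase_subset _ _)
    rw [e1, Finset.prod_union d1, gprod, fprod, hprod, ← Finset.mul_prod_erase J _ hk]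
    have e2 : gg c a k = c * (a - k)⁻¹ := by unfold gg; rw [div_eq_mul_inv]
    rw [e2]
    ring
  · refine Finset.sum_congr rfl (fun k hk => ?_)
    have hkQ : k ∉ J := Finset.disjoint_right.mp hJQ hk
    have e1 : (J ∪ Q).erase k = J ∪ Q.erase k := by
      rw [Finset.erase_union_distrib, Finset.erase_eq_of_notMem hkQ]
    have d1 : Disjoint J (Q.erase k) := hJQ.mono_right (Finset.erase_subset _ _)
    rw [e1, Finset.prod_union d1, gprod, fprod, hprod]
    have e2 : gg c k a = -c * (a - k)⁻¹ := by
      unfold gg; rw [← neg_sub a k, div_neg, neg_mul, div_eq_mul_inv]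
    have e3 : Q.card = (Q.erase k).card + 1 := (Finset.card_erase_add_one hk).symm
    rw [e2, e3]
    ring

/-! ### Finset form of X -/

def PG (c : ℂ) (s t : Finset ℂ) : ℂ := ∏ x ∈ s, ∏ y ∈ t, gg c x y
def PF (c : ℂ) (s t : Finset ℂ) : ℂ := ∏ x ∈ s, ∏ y ∈ t, ff c x y
def PH (c : ℂ) (s : Finset ℂ) : ℂ := ∏ x ∈ s, ∏ y ∈ s, if x ≠ y then hh c x y else 1

def XTerm (c : ℂ) (T : Fin 3 → Fin 3 → ℂ → A) (U V S Q : Finset ℂ) : A :=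
  (PG c Q S * PF c S (U \ S) * PG c (V \ Q) Q * PH c S) •
    (TTf c (T 0 2) S * TPf (T 0 1) (U \ S) * TTf c (T 1 2) (V \ Q) * TPf (T 1 1) Q)

def XF (c : ℂ) (T : Fin 3 → Fin 3 → ℂ → A) (U V : Finset ℂ) : A :=
  ∑ S ∈ U.powerset, ∑ Q ∈ V.powerset, if S.card = Q.card then XTerm c T U V S Q else 0

lemma prodGG_eq (c : ℂ) {l m : List ℂ} (hl : l.Nodup) (hm : m.Nodup) :
    prodGG c l m = PG c l.toFinset m.toFinset := by
  unfold prodGG PG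
  rw [List.prod_toFinset _ hl]
  simp only [List.prod_toFinset _ hm]

lemma prodFF_eq (c : ℂ) {l m : List ℂ} (hl : l.Nodup) (hm : m.Nodup) :
    prodFF c l m = PF c l.toFinset m.toFinset := by
  unfold prodFF PF
  rw [List.prod_toFinset _ hl]
  simp only [List.prod_toFinset _ hm]

lemma prod_fin_get (l : List ℂ) (F : ℂ → ℂ) : ∏ j : Fin l.length, F (l.get j) = (l.map F).prod := by
  rw [← List.prod_ofFn]
  congr 1
  conv_rhs => rw [← List.ofFn_get l, List.map_ofFn]
  rfl

lemma prodHHne_eq (c : ℂ) {l : List ℂ} (hl : l.Nodup) : prodHHne c l = PH c l.toFinset := by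
  unfold prodHHne PH
  rw [List.prod_toFinset _ hl]
  simp only [List.prod_toFinset _ hl]
  rw [← prod_fin_get]
  refine Finset.prod_congr rfl (fun j _ => ?_)
  rw [← prod_fin_get]
  refine Finset.prod_congr rfl (fun k _ => ?_)
  simp only [ne_eq, (List.nodup_iff_injective_get.mp hl).eq_iff]

lemma sel_nodup {l : List ℂ} (hl : l.Nodup) (S : Finset (Fin l.length)) : (sel l S).Nodup :=
  (Finset.sort_nodup _ _).map (List.nodup_iff_injective_get.mp hl)

lemma sel_toFinset (l : List ℂ) (S : Finset (Fin l.length)) :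
    (sel l S).toFinset = S.image l.get := by
  ext x; simp [sel]

lemma univ_image_get (l : List ℂ) : (Finset.univ : Finset (Fin l.length)).image l.get = l.toFinset := by
  ext x; simp [List.mem_iff_get]

lemma sel_compl {l : List ℂ} (hl : l.Nodup) (S : Finset (Fin l.length)) :
    (sel l Sᶜ).toFinset = l.toFinset \ S.image l.get := by
  rw [sel_toFinset, Finset.compl_eq_univ_sdiff,
    Finset.image_sdiff_of_injOn (List.nodup_iff_injective_get.mp hl).injOn (Finset.subset_univ _), univ_image_get]

lemma sum_image {M : Type*} [AddCommMonoid M] {l : List ℂ} (hl : l.Nodup) (F : Finset ℂ → M) :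
    ∑ S : Finset (Fin l.length), F (S.image l.get) = ∑ S ∈ l.toFinset.powerset, F S := by
  have hinj := List.nodup_iff_injective_get.mp hl
  rw [← univ_image_get, Finset.powerset_image, Finset.sum_image]
  · simp
  · exact (Finset.image_injective hinj).injOn

lemma toList_perm {l : List ℂ} (hl : l.Nodup) : l.Perm l.toFinset.toList :=
  (List.perm_ext_iff_of_nodup hl (Finset.nodup_toList _)).mpr (by simp)

lemma X_eq {c : ℂ} (hc : c ≠ 0) {T : Fin 3 → Fin 3 → ℂ → A} (hT : IsTFam c p21 T)
    {u v : List ℂ} (hu : u.Nodup) (hv : v.Nodup) (hU : FA c u.toFinset) (hV : FA c v.toFinset) :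
    X c T u v = XF c T u.toFinset v.toFinset := by
  unfold X XF
  rw [← sum_image hu]
  refine Finset.sum_congr rfl (fun S _ => ?_)
  rw [← sum_image hv]
  refine Finset.sum_congr rfl (fun Q _ => ?_)
  rw [Finset.card_image_of_injective _ (List.nodup_iff_injective_get.mp hu),
    Finset.card_image_of_injective _ (List.nodup_iff_injective_get.mp hv)]
  have n1 := sel_nodup hu S
  have n2 := sel_nodup hu Sᶜ
  have n3 := sel_nodup hv Q
  have n4 := sel_nodup hv Qᶜ
  have m1 : ∀ x ∈ sel u S, x ∈ u.toFinset := by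
    intro x hx; simp only [sel, List.mem_map] at hx
    obtain ⟨i, -, rfl⟩ := hx; simp
  have m4 : ∀ x ∈ sel v Qᶜ, x ∈ v.toFinset := by
    intro x hx; simp only [sel, List.mem_map] at hx
    obtain ⟨i, -, rfl⟩ := hx; simp
  rw [TT_perm hc (ferm02 hc hT) (toList_perm n1) (hU.pairwise n1 m1),
    TT_perm hc (ferm12 hc hT) (toList_perm n4) (hV.pairwise n4 m4),
    Tprod_perm (comm01 hT) (toList_perm n2), Tprod_perm (comm11 hT) (toList_perm n3),
    prodGG_eq c n3 n1, prodFF_eq c n1 n2, prodGG_eq c n4 n3, prodHHne_eq c n1,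
    sel_compl hu, sel_compl hv, sel_toFinset, sel_toFinset]
  rfl

/-! ### Reindexing -/

lemma reindex1 {M : Type*} [AddCommMonoid M] (U : Finset ℂ) (F : Finset ℂ → ℂ → M) :
    ∑ S ∈ U.powerset, ∑ k ∈ S, F S k = ∑ I ∈ U.powerset, ∑ k ∈ U \ I, F (insert k I) k := by
  rw [Finset.sum_sigma', Finset.sum_sigma']
  refine Finset.sum_bij' (fun p _ => ⟨p.1.erase p.2, p.2⟩) (fun p _ => ⟨insert p.2 p.1, p.2⟩)
    ?_ ?_ ?_ ?_ ?_
  · rintro ⟨S, k⟩ h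
    simp only [Finset.mem_sigma, Finset.mem_powerset, Finset.mem_sdiff] at h ⊢
    exact ⟨(Finset.erase_subset _ _).trans h.1, h.1 h.2, by simp⟩
  · rintro ⟨S, k⟩ h
    simp only [Finset.mem_sigma, Finset.mem_powerset, Finset.mem_sdiff] at h ⊢
    exact ⟨Finset.insert_subset h.2.1 h.1, by simp⟩
  · rintro ⟨S, k⟩ h
    simp only [Finset.mem_sigma] at h
    simp [Finset.insert_erase h.2]
  · rintro ⟨S, k⟩ h
    simp only [Finset.mem_sigma, Finset.mem_sdiff] at h
    simp [Finset.erase_insert h.2.2]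
  · rintro ⟨S, k⟩ h
    simp only [Finset.mem_sigma] at h
    simp [Finset.insert_erase h.2]

lemma reindex2 {M : Type*} [AddCommMonoid M] (V : Finset ℂ) (F : ℂ → Finset ℂ → M) :
    ∑ j ∈ V, ∑ Q ∈ (V.erase j).powerset, F j Q = ∑ Q ∈ V.powerset, ∑ j ∈ Q, F j (Q.erase j) := by
  rw [Finset.sum_sigma', Finset.sum_sigma']
  refine Finset.sum_bij' (fun p _ => ⟨insert p.1 p.2, p.1⟩) (fun p _ => ⟨p.2, p.1.erase p.2⟩)
    ?_ ?_ ?_ ?_ ?_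
  · rintro ⟨j, Q⟩ h
    simp only [Finset.mem_sigma, Finset.mem_powerset] at h ⊢
    exact ⟨Finset.insert_subset h.1 (h.2.trans (Finset.erase_subset _ _)), by simp⟩
  · rintro ⟨Q, j⟩ h
    simp only [Finset.mem_sigma, Finset.mem_powerset] at h ⊢
    exact ⟨h.1 h.2, Finset.erase_subset_erase _ h.1⟩
  · rintro ⟨j, Q⟩ h
    simp only [Finset.mem_sigma, Finset.mem_powerset] at h
    have : j ∉ Q := fun hj => by simpa using h.2 hj
    simp [Finset.erase_insert this]
  · rintro ⟨Q, j⟩ h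
    simp only [Finset.mem_sigma] at h
    simp [Finset.insert_erase h.2]
  · rintro ⟨j, Q⟩ h
    simp only [Finset.mem_sigma, Finset.mem_powerset] at h
    have : j ∉ Q := fun hj => by simpa using h.2 hj
    simp [Finset.erase_insert this]

/-! ### Product rules -/

lemma PG_insert_right (c : ℂ) {s t : Finset ℂ} {k : ℂ} (hk : k ∉ t) :
    PG c s (insert k t) = (∏ x ∈ s, gg c x k) * PG c s t := by
  unfold PG
  rw [← Finset.prod_mul_distrib]
  exact Finset.prod_congr rfl (fun x _ => Finset.prod_insert hk)

lemma PG_insert_left (c : ℂ) {s t : Finset ℂ} {k : ℂ} (hk : k ∉ s) :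
    PG c (insert k s) t = (∏ y ∈ t, gg c k y) * PG c s t := Finset.prod_insert hk

lemma PF_insert_right (c : ℂ) {s t : Finset ℂ} {k : ℂ} (hk : k ∉ t) :
    PF c s (insert k t) = (∏ x ∈ s, ff c x k) * PF c s t := by
  unfold PF
  rw [← Finset.prod_mul_distrib]
  exact Finset.prod_congr rfl (fun x _ => Finset.prod_insert hk)

lemma PF_insert_left (c : ℂ) {s t : Finset ℂ} {k : ℂ} (hk : k ∉ s) :
    PF c (insert k s) t = (∏ y ∈ t, ff c k y) * PF c s t := Finset.prod_insert hk

lemma PH_insert (c : ℂ) {s : Finset ℂ} {k : ℂ} (hk : k ∉ s) :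
    PH c (insert k s) = (∏ y ∈ s, hh c k y) * (∏ x ∈ s, hh c x k) * PH c s := by
  unfold PH
  rw [Finset.prod_insert hk, Finset.prod_insert hk]
  have e1 : ∀ y ∈ s, (if k ≠ y then hh c k y else 1) = hh c k y := fun y hy =>
    if_pos (by rintro rfl; exact hk hy)
  have e2 : ∀ x ∈ s, (∏ y ∈ insert k s, if x ≠ y then hh c x y else 1)
      = hh c x k * ∏ y ∈ s, if x ≠ y then hh c x y else 1 := by
    intro x hx
    rw [Finset.prod_insert hk, if_pos (by rintro rfl; exact hk hx)]
  rw [Finset.prod_congr rfl e1, Finset.prod_congr rfl e2, Finset.prod_mul_distrib]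
  simp [mul_assoc]

lemma prod_ff (c : ℂ) (hc : c ≠ 0) (s : Finset ℂ) (x : ℂ) :
    ∏ y ∈ s, ff c x y = (∏ y ∈ s, gg c x y) * ∏ y ∈ s, hh c x y := by
  rw [← Finset.prod_mul_distrib]; exact Finset.prod_congr rfl (fun _ _ => ff_eq hc)

lemma prod_ff' (c : ℂ) (hc : c ≠ 0) (s : Finset ℂ) (x : ℂ) :
    ∏ y ∈ s, ff c y x = (∏ y ∈ s, gg c y x) * ∏ y ∈ s, hh c y x := by
  rw [← Finset.prod_mul_distrib]; exact Finset.prod_congr rfl (fun _ _ => ff_eq hc)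

/-! ### The recursion -/

/-- the common operator -/
def OPf (c : ℂ) (T : Fin 3 → Fin 3 → ℂ → A) (a : ℂ) (U V I Q : Finset ℂ) : A :=
  TTf c (T 0 2) (insert a I) * TPf (T 0 1) (U \ I) * TTf c (T 1 2) (V \ Q) * TPf (T 1 1) Q

/-- the common scalar -/
def Kf (c a : ℂ) (U V I Q : Finset ℂ) : ℂ :=
  PG c Q I * PF c I (U \ I) * PG c (V \ Q) Q * PH c I * ∏ x ∈ I, hh c x a

/-- exchange terms -/
def Ef (c : ℂ) (T : Fin 3 → Fin 3 → ℂ → A) (a : ℂ) (U V S : Finset ℂ) (k : ℂ) (Q : Finset ℂ) : A :=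
  ((PG c Q S * PF c S (U \ S) * PG c (V \ Q) Q * PH c S) *
    (gg c a k * ∏ x ∈ S.erase k, (gg c x k * hh c x a))) •
    (TTf c (T 0 2) (insert a (S.erase k)) * T 0 1 k * TPf (T 0 1) (U \ S) *
      TTf c (T 1 2) (V \ Q) * TPf (T 1 1) Q)

lemma XTerm_insert {c : ℂ} (T : Fin 3 → Fin 3 → ℂ → A) {a : ℂ} {U V I Q : Finset ℂ}
    (haU : a ∉ U) (hI : I ⊆ U) :
    XTerm c T (insert a U) V (insert a I) Q
      = (Kf c a U V I Q * ((∏ v ∈ Q, gg c v a) * (∏ u ∈ U \ I, ff c a u) * ∏ u ∈ I, hh c a u)) •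
        OPf c T a U V I Q := by
  have haI : a ∉ I := fun h => haU (hI h)
  have e : insert a U \ insert a I = U \ I := by
    ext x; simp only [Finset.mem_sdiff, Finset.mem_insert]
    constructor
    · tauto
    · rintro ⟨h1, h2⟩
      exact ⟨Or.inr h1, fun h => h.elim (fun h => haU (h ▸ h1)) h2⟩
  unfold XTerm OPf Kf
  rw [e, PG_insert_right c haI, PF_insert_left c haI, PH_insert c haI]
  congr 1
  ring

lemma T_mul_XTerm {c : ℂ} (hc : c ≠ 0) {T : Fin 3 → Fin 3 → ℂ → A} (hT : IsTFam c p21 T)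
    {a : ℂ} {U V S Q : Finset ℂ} (haU : a ∉ U) (hS : S ⊆ U) (hF : FA c (insert a U)) :
    T 0 1 a * XTerm c T U V S Q = XTerm c T (insert a U) V S Q + ∑ k ∈ S, Ef c T a U V S k Q := by
  have haS : a ∉ S := fun h => haU (hS h)
  have haUS : a ∉ U \ S := fun h => haU (Finset.mem_sdiff.mp h).1
  unfold XTerm Ef
  rw [Finset.insert_sdiff_of_notMem _ haS, PF_insert_right c haUS,
    TPf_insert (comm01 hT) haUS, mul_smul_comm, ← mul_assoc, ← mul_assoc, ← mul_assoc,
    exch hc hT S a haS (hF.mono (Finset.insert_subset_insert _ hS))]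
  simp only [add_mul, smul_add, Finset.sum_mul, Finset.smul_sum, smul_mul_assoc, smul_smul,
    mul_assoc]
  congr 2
  ring

lemma Ef_eq {c : ℂ} (hc : c ≠ 0) {T : Fin 3 → Fin 3 → ℂ → A} (hT : IsTFam c p21 T)
    {a : ℂ} {U V I Q : Finset ℂ} {k : ℂ} (hk : k ∈ U \ I) :
    Ef c T a U V (insert k I) k Q
      = (Kf c a U V I Q * ((∏ v ∈ Q, gg c v k) * (∏ u ∈ (U \ I).erase k, ff c k u) *
          (∏ u ∈ I, hh c k u) * gg c a k)) • OPf c T a U V I Q := by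
  have hkI : k ∉ I := (Finset.mem_sdiff.mp hk).2
  have e1 : U \ insert k I = (U \ I).erase k := by
    rw [Finset.sdiff_insert]
  have e2 : U \ I = insert k ((U \ I).erase k) := (Finset.insert_erase hk).symm
  have hke : k ∉ (U \ I).erase k := Finset.notMem_erase _ _
  unfold Ef OPf Kf
  rw [e1, Finset.erase_insert hkI]
  have e3 : TPf (T 0 1) (U \ I) = T 0 1 k * TPf (T 0 1) ((U \ I).erase k) := by
    conv_lhs => rw [e2]
    exact TPf_insert (comm01 hT) hke
  have e4 : PF c I (U \ I) = (∏ x ∈ I, ff c x k) * PF c I ((U \ I).erase k) := by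
    conv_lhs => rw [e2]
    exact PF_insert_right c hke
  rw [e3, e4, PG_insert_right c hkI, PF_insert_left c hkI, PH_insert c hkI, prod_ff' c hc I k,
    Finset.prod_mul_distrib]
  simp only [mul_assoc]
  congr 1
  ring

lemma D_eq {c : ℂ} (hc : c ≠ 0) {T : Fin 3 → Fin 3 → ℂ → A} (hT : IsTFam c p21 T)
    {a : ℂ} {U V I Q : Finset ℂ} {j : ℂ} (haU : a ∉ U) (hF : FA c (insert a U)) (hI : I ⊆ U)
    (hQ : Q ⊆ V) (hj : j ∈ Q) :
    (gg c j a * (∏ u ∈ U, ff c j u) * ∏ x ∈ V.erase j, gg c x j) •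
        (T 0 2 a * XTerm c T U (V.erase j) I (Q.erase j) * T 1 1 j)
      = (Kf c a U V I Q * (gg c j a * (∏ u ∈ U \ I, ff c j u) * (∏ u ∈ I, hh c j u) *
          ∏ v ∈ Q.erase j, gg c v j)) • OPf c T a U V I Q := by
  have haI : a ∉ I := fun h => haU (hI h)
  have hje : j ∉ Q.erase j := Finset.notMem_erase _ _
  have e1 : V.erase j \ Q.erase j = V \ Q := by
    ext x; simp only [Finset.mem_sdiff, Finset.mem_erase]
    constructor
    · tauto
    · rintro ⟨h1, h2⟩
      exact ⟨⟨fun h => h2 (h ▸ hj), h1⟩, fun h => h2 h.2⟩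
  have e2 : V.erase j = (V \ Q) ∪ Q.erase j := by
    rw [← e1, Finset.sdiff_union_of_subset (Finset.erase_subset_erase _ hQ)]
  have d2 : Disjoint (V \ Q) (Q.erase j) := by
    rw [← e1]; exact Finset.sdiff_disjoint
  have e3 : Q = insert j (Q.erase j) := (Finset.insert_erase hj).symm
  have e4 : TPf (T 1 1) Q = TPf (T 1 1) (Q.erase j) * T 1 1 j := by
    conv_lhs => rw [e3]
    exact TPf_insert' (comm11 hT) hje
  have e5 : PG c Q I = (∏ y ∈ I, gg c j y) * PG c (Q.erase j) I := by
    conv_lhs => rw [e3]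
    exact PG_insert_left c hje
  have e6 : PG c (V \ Q) Q = (∏ x ∈ V \ Q, gg c x j) * PG c (V \ Q) (Q.erase j) := by
    have := PG_insert_right c (s := V \ Q) hje
    rwa [← e3] at this
  have e7 : ∏ u ∈ U, ff c j u = (∏ u ∈ U \ I, ff c j u) * ∏ u ∈ I, ff c j u :=
    (Finset.prod_sdiff hI).symm
  have e8 : ∏ x ∈ V.erase j, gg c x j = (∏ x ∈ V \ Q, gg c x j) * ∏ x ∈ Q.erase j, gg c x j := by
    rw [e2, Finset.prod_union d2]
  unfold XTerm OPf Kf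
  rw [e1, e4, e5, e6, e7, e8, prod_ff c hc I j, mul_smul_comm,
    ← mul_assoc (T 0 2 a), ← mul_assoc (T 0 2 a), ← mul_assoc (T 0 2 a), mul_TTf hc (ferm02 hc hT) haI (hF.mono (Finset.insert_subset_insert _ hI))]
  simp only [smul_mul_assoc, smul_smul, mul_assoc]
  congr 1
  ring

lemma XF_rec {c : ℂ} (hc : c ≠ 0) {T : Fin 3 → Fin 3 → ℂ → A} (hT : IsTFam c p21 T)
    {a : ℂ} {U V : Finset ℂ} (haU : a ∉ U) (haV : a ∉ V) (hUV : Disjoint U V)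
    (hF : FA c (insert a U)) :
    XF c T (insert a U) V = T 0 1 a * XF c T U V
      + ∑ j ∈ V, (gg c j a * (∏ u ∈ U, ff c j u) * ∏ x ∈ V.erase j, gg c x j) •
        (T 0 2 a * XF c T U (V.erase j) * T 1 1 j) := by
  have s1 : T 0 1 a * XF c T U V
      = (∑ S ∈ U.powerset, ∑ Q ∈ V.powerset,
          if S.card = Q.card then XTerm c T (insert a U) V S Q else 0)
        + ∑ I ∈ U.powerset, ∑ Q ∈ V.powerset, if I.card + 1 = Q.card then
            ∑ k ∈ U \ I, Ef c T a U V (insert k I) k Q else 0 := by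
    have r : ∑ I ∈ U.powerset, ∑ Q ∈ V.powerset, (if I.card + 1 = Q.card then
            ∑ k ∈ U \ I, Ef c T a U V (insert k I) k Q else 0)
        = ∑ S ∈ U.powerset, ∑ Q ∈ V.powerset, if S.card = Q.card then
            ∑ k ∈ S, Ef c T a U V S k Q else 0 := by
      have r2 := reindex1 U (fun S k => ∑ Q ∈ V.powerset,
        if S.card = Q.card then Ef c T a U V S k Q else 0)
      have r3 : ∑ S ∈ U.powerset, ∑ Q ∈ V.powerset, (if S.card = Q.card then
            ∑ k ∈ S, Ef c T a U V S k Q else 0)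
          = ∑ S ∈ U.powerset, ∑ k ∈ S, ∑ Q ∈ V.powerset,
            if S.card = Q.card then Ef c T a U V S k Q else 0 := by
        refine Finset.sum_congr rfl (fun S _ => ?_)
        rw [Finset.sum_comm]
        refine Finset.sum_congr rfl (fun Q _ => ?_)
        split_ifs <;> simp
      rw [r3, r2]
      refine Finset.sum_congr rfl (fun I _ => ?_)
      rw [Finset.sum_comm]
      refine Finset.sum_congr rfl (fun Q _ => ?_)
      have r4 : ∀ k ∈ U \ I, (if (insert k I).card = Q.card then
          Ef c T a U V (insert k I) k Q else 0)
          = if I.card + 1 = Q.card then Ef c T a U V (insert k I) k Q else 0 := by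
        intro k hk
        rw [Finset.card_insert_of_notMem (Finset.mem_sdiff.mp hk).2]
      rw [Finset.sum_congr rfl r4]
      split_ifs <;> simp
    rw [r]
    unfold XF
    simp only [Finset.mul_sum, ← Finset.sum_add_distrib]
    refine Finset.sum_congr rfl (fun S hS => Finset.sum_congr rfl (fun Q _ => ?_))
    split_ifs
    · exact T_mul_XTerm hc hT haU (Finset.mem_powerset.mp hS) hF
    · simp
  have s2 : ∑ j ∈ V, (gg c j a * (∏ u ∈ U, ff c j u) * ∏ x ∈ V.erase j, gg c x j) •
        (T 0 2 a * XF c T U (V.erase j) * T 1 1 j)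
      = ∑ I ∈ U.powerset, ∑ Q ∈ V.powerset, if I.card + 1 = Q.card then
          ∑ j ∈ Q, (gg c j a * (∏ u ∈ U, ff c j u) * ∏ x ∈ V.erase j, gg c x j) •
            (T 0 2 a * XTerm c T U (V.erase j) I (Q.erase j) * T 1 1 j) else 0 := by
    unfold XF
    simp only [Finset.mul_sum, Finset.sum_mul, Finset.smul_sum]
    rw [Finset.sum_comm]
    refine Finset.sum_congr rfl (fun I _ => ?_)
    rw [reindex2 V (fun j Q => (gg c j a * (∏ u ∈ U, ff c j u) * ∏ x ∈ V.erase j, gg c x j) •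
      (T 0 2 a * (if I.card = Q.card then XTerm c T U (V.erase j) I Q else 0) * T 1 1 j))]
    refine Finset.sum_congr rfl (fun Q _ => ?_)
    have r4 : ∀ j ∈ Q, (gg c j a * (∏ u ∈ U, ff c j u) * ∏ x ∈ V.erase j, gg c x j) •
      (T 0 2 a * (if I.card = (Q.erase j).card then XTerm c T U (V.erase j) I (Q.erase j) else 0)
          * T 1 1 j)
        = if I.card + 1 = Q.card then
          (gg c j a * (∏ u ∈ U, ff c j u) * ∏ x ∈ V.erase j, gg c x j) •
            (T 0 2 a * XTerm c T U (V.erase j) I (Q.erase j) * T 1 1 j) else 0 := by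
      intro j hj
      have := Finset.card_erase_add_one hj
      by_cases h : I.card + 1 = Q.card
      · rw [if_pos h, if_pos (by omega)]
      · rw [if_neg h, if_neg (by omega)]; simp
    rw [Finset.sum_congr rfl r4]
    split_ifs <;> simp
  rw [s1, s2, XF, Finset.sum_powerset_insert haU, add_assoc]
  congr 1
  simp only [← Finset.sum_add_distrib]
  refine Finset.sum_congr rfl (fun I hI => Finset.sum_congr rfl (fun Q hQ => ?_))
  have hI' := Finset.mem_powerset.mp hI
  have hQ' := Finset.mem_powerset.mp hQ
  rw [Finset.card_insert_of_notMem (fun h => haU (hI' h))]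
  split_ifs with h
  · rw [XTerm_insert T haU hI', Finset.sum_congr rfl (fun k hk => Ef_eq hc hT hk),
      Finset.sum_congr rfl (fun j hj => D_eq hc hT haU hF hI' hQ' hj),
      ← Finset.sum_smul, ← Finset.sum_smul, ← add_smul, ← Finset.mul_sum, ← Finset.mul_sum,
      ← mul_add, ← partial_fractions hc h (hUV.mono Finset.sdiff_subset hQ')
        (fun h => haU (Finset.mem_sdiff.mp h).1) (fun h => haV (hQ' h))]
  · simp

/-- recursion for the operator `X_{a,b}(ū,v̄)`. -/
theorem statement3 (c : ℂ) (hc : c ≠ 0) (T : Fin 3 → Fin 3 → ℂ → A)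
    (hT : IsTFam c p21 T) (u' : List ℂ) (ua : ℂ) (v : List ℂ)
    (hadm : Admissible c ((u' ++ [ua]) ++ v)) :
    X c T (u' ++ [ua]) v
      = T 0 1 ua * X c T u' v
        + ∑ j : Fin v.length,
            (gg c (v.get j) ua * prodFF c [v.get j] u' *
                prodGG c (v.eraseIdx (j : ℕ)) [v.get j]) •
              (T 0 2 ua * X c T u' (v.eraseIdx (j : ℕ)) * T 1 1 (v.get j)) := by
  have hn : ((u' ++ [ua]) ++ v).Nodup := hadm.imp (fun h => h.1)
  have hA : FA c ((u' ++ [ua]) ++ v).toFinset := by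
    intro x hx y hy hxy
    have hsymm : Std.Symm (GP c) := ⟨fun _ _ h => GP.symm h⟩
    exact List.Pairwise.forall (R := GP c) hadm (List.mem_toFinset.mp hx)
      (List.mem_toFinset.mp hy) hxy
  have hn1 := (List.nodup_append.mp hn).1
  have hv := (List.nodup_append.mp hn).2.1
  have hu := (List.nodup_append.mp hn1).1
  have hU1 : FA c (u' ++ [ua]).toFinset := hA.mono (by
    intro x hx; rw [List.mem_toFinset] at hx ⊢; exact List.mem_append_left _ hx)
  have hV : FA c v.toFinset := hA.mono (by
    intro x hx; rw [List.mem_toFinset] at hx ⊢; exact List.mem_append_right _ hx)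
  have eU : (u' ++ [ua]).toFinset = insert ua u'.toFinset := by
    ext x; simp
  have hU : FA c u'.toFinset := hU1.mono (by rw [eU]; exact Finset.subset_insert _ _)
  have haU : ua ∉ u'.toFinset := by
    intro h
    exact (List.nodup_append.mp hn1).2.2 ua (List.mem_toFinset.mp h) ua (by simp) rfl
  have haV : ua ∉ v.toFinset := by
    intro h
    exact (List.nodup_append.mp hn).2.2 ua (by simp) ua (List.mem_toFinset.mp h) rfl
  have hUV : Disjoint u'.toFinset v.toFinset := by
    rw [Finset.disjoint_left]
    intro x hx hx'
    exact (List.nodup_append.mp hn).2.2 x (by simp [List.mem_toFinset.mp hx]) x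
      (List.mem_toFinset.mp hx') rfl
  have eE : ∀ j : Fin v.length, (v.eraseIdx (j : ℕ)).toFinset = v.toFinset.erase (v.get j) := by
    intro j
    have hej : v.eraseIdx (j : ℕ) = v.erase (v.get j) := by
      exact (List.Nodup.erase_get hv j).symm
    rw [hej]
    ext x
    simp only [List.mem_toFinset, Finset.mem_erase, hv.mem_erase_iff]
  have hnE : ∀ j : Fin v.length, (v.eraseIdx (j : ℕ)).Nodup := fun j =>
    hv.sublist (List.eraseIdx_sublist _ _)
  rw [X_eq hc hT hn1 hv hU1 hV, X_eq hc hT hu hv hU hV, eU,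
    XF_rec hc hT haU haV hUV (by rw [← eU]; exact hU1)]
  congr 1
  rw [← univ_image_get v, Finset.sum_image (List.nodup_iff_injective_get.mp hv).injOn]
  refine Finset.sum_congr rfl (fun j _ => ?_)
  rw [univ_image_get v, X_eq hc hT hu (hnE j) hU
    (by rw [eE]; exact hV.mono (Finset.erase_subset _ _)), eE,
    prodFF_eq c (List.nodup_singleton _) hu, prodGG_eq c (hnE j) (List.nodup_singleton _), eE]
  simp [PF, PG]

end Bethe
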